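/- Let k ≥ 3 and let 𝔸 be a finite multiset of positive integers with distinct values a_1 < ... < a_k, multiplicities r_i ≥ 1, and gcd(a_1, ..., a_k) = 1. If a_k ≤ 2k - 3, then |S(𝔸)| ≥ Σ_{i=1}^{k} i·r_i + a_k - k; if a_k ≥ 2k - 2, then |S(𝔸)| ≥ Σ_{i=1}^{k} i·r_i + θ(k+1) - k - 4, where θ = (1+√5)/2. -/

import Mathlib

open Pointwise

/-- Set of all nonempty subset sums of a finite set of integers. -/
def SetSub (A : Finset ℤ) : Finset ℤ :=
  (A.powerset.filter (fun B => B.Nonempty)).image fun B => B.sum id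

/-- Set of all subset sums over subsets of cardinality at least `α`. -/
def SetSubAlpha (α : ℕ) (A : Finset ℤ) : Finset ℤ :=
  (A.powerset.filter (fun B => α ≤ B.card)).image fun B => B.sum id

/-- Set of all nonempty subsequence (sub-multiset) sums of a multiset of integers. -/
def SeqSub (A : Multiset ℤ) : Finset ℤ :=
  ((A.powerset.filter (fun B => B ≠ 0)).map Multiset.sum).toFinset

/-- Set of all sub-multiset sums with at least `α` terms. -/
def SeqSubAlpha (α : ℕ) (A : Multiset ℤ) : Finset ℤ :=
  ((A.powerset.filter (fun B => α ≤ Multiset.card B)).map Multiset.sum).toFinset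

/-- `h`-fold sumset of a finite set of integers. -/
def hfold : ℕ → Finset ℤ → Finset ℤ
  | 0, _ => {0}
  | n + 1, X => X + hfold n X

/-- Restricted 2-fold sumset: sums of two distinct elements. -/
def Res2 (A : Finset ℤ) : Finset ℤ :=
  ((A ×ˢ A).filter (fun p => p.1 ≠ p.2)).image fun p => p.1 + p.2

/-- The golden ratio. -/
noncomputable def theta : ℝ := (1 + Real.sqrt 5) / 2

section SubsetSums

variable {G : Type*} [AddCommGroup G] [DecidableEq G]

/-- The sums of all sub-multisets of `M`, including the empty one. -/
def allSums (M : Multiset G) : Finset G := (M.powerset.map Multiset.sum).toFinset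

theorem mem_allSums {M : Multiset G} {x : G} : x ∈ allSums M ↔ ∃ B ≤ M, B.sum = x := by
  simp [allSums]

theorem allSums_zero : allSums (0 : Multiset G) = {0} := by
  ext x; simp [mem_allSums, eq_comm]

theorem mem_allSums_cons {M : Multiset G} {a x : G} :
    x ∈ allSums (a ::ₘ M) ↔ x ∈ allSums M ∨ x - a ∈ allSums M := by
  simp only [allSums, Multiset.powerset_cons, Multiset.map_add, Multiset.toFinset_add,
    Finset.mem_union, Multiset.mem_toFinset, Multiset.map_map, Multiset.mem_map,
    Function.comp_apply, Multiset.sum_cons, eq_sub_iff_add_eq']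

theorem allSums_cons (a : G) (M : Multiset G) :
    allSums (a ::ₘ M) = allSums M ∪ (allSums M).image (· + a) := by
  ext x
  simp only [mem_allSums_cons, Finset.mem_union, Finset.mem_image]
  refine or_congr Iff.rfl ⟨fun h => ⟨_, h, by abel⟩, ?_⟩
  rintro ⟨y, hy, rfl⟩
  simpa using hy

theorem zero_mem_allSums (M : Multiset G) : 0 ∈ allSums M :=
  mem_allSums.2 ⟨0, zero_le, by simp⟩

theorem mem_allSums_of_mem {M : Multiset G} {a : G} (h : a ∈ M) : a ∈ allSums M :=
  mem_allSums.2 ⟨{a}, by simpa using h, by simp⟩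

theorem allSums_mono {M N : Multiset G} (h : M ≤ N) : allSums M ⊆ allSums N := fun x hx => by
  obtain ⟨B, hB, rfl⟩ := mem_allSums.1 hx
  exact mem_allSums.2 ⟨B, hB.trans h, rfl⟩

theorem allSums_map {H : Type*} [AddCommGroup H] [DecidableEq H] (f : G →+ H) (M : Multiset G) :
    allSums (M.map f) = (allSums M).image f := by
  induction M using Multiset.induction_on with
  | empty => simp [allSums_zero]
  | cons a M ih =>
    rw [Multiset.map_cons, allSums_cons, allSums_cons, ih, Finset.image_union, Finset.image_image,
      Finset.image_image]
    congr 2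
    ext x
    simp

theorem card_union_image_add (X : Finset G) (a : G) :
    (X ∪ X.image (· + a)).card = X.card + (X.filter (fun x => x + a ∉ X)).card := by
  have h : X ∪ X.image (· + a) = X ∪ (X.filter (fun x => x + a ∉ X)).image (· + a) := by
    ext x
    simp only [Finset.mem_union, Finset.mem_image, Finset.mem_filter]
    by_cases hx : x ∈ X
    · simp [hx]
    · simp only [hx, false_or]
      constructor
      · rintro ⟨y, hy, rfl⟩
        exact ⟨y, ⟨hy, hx⟩, rfl⟩
      · rintro ⟨y, hy, rfl⟩
        exact ⟨y, hy.1, rfl⟩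
  rw [h, Finset.card_union_of_disjoint, Finset.card_image_of_injective _ (add_left_injective a)]
  rw [Finset.disjoint_left]
  intro x hx hx'
  obtain ⟨y, hy, rfl⟩ := Finset.mem_image.1 hx'
  exact (Finset.mem_filter.1 hy).2 hx

/-- As many points enter a finite set as leave it under a translation. -/
theorem card_enter_eq_card_leave (D : Finset G) (s : G) :
    ((D.image (· - s)) \ D).card = (D.filter (fun x => x + s ∉ D)).card := by
  have h : D.filter (fun x => x + s ∉ D) = D \ D.image (· - s) := by
    ext x
    simp [sub_eq_iff_eq_add]
  rw [h]
  exact Finset.card_sdiff_comm (Finset.card_image_of_injective _ (sub_left_injective))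

omit [DecidableEq G] in
theorem add_mem_of_closed [Finite G] {S T : Set G} (hT : ∀ v ∈ T, ∀ t ∈ S, v + t ∈ T) {v h : G}
    (hv : v ∈ T) (hh : h ∈ AddSubgroup.closure S) : v + h ∈ T := by
  have hh' : h ∈ AddSubmonoid.closure S := by
    rw [← AddSubgroup.closure_toAddSubmonoid_of_finite]; exact hh
  induction hh' using AddSubmonoid.closure_induction_right with
  | zero => simpa using hv
  | add_right x hx y hy ih =>
    rw [← add_assoc]
    refine hT _ (ih ?_) _ hy
    rw [← AddSubgroup.closure_toAddSubmonoid_of_finite] at hx; exact hx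

theorem isolated_or_hole {D : Finset G} {s t x : G}
    (hP : ∀ u ∈ ({s, t} : Set G), ∀ y z, y ∈ D → y + u ∉ D → z ∈ D → z + u ∉ D → y = z)
    (hQ : ∀ u ∈ ({s, t} : Set G), ∀ y z, y ∉ D → y + u ∈ D → z ∉ D → z + u ∈ D → y = z)
    (ht : t ≠ 0) (hst : s ≠ t) (hst' : s ≠ -t) (hx : x ∈ D) (hxs : x + s ∉ D) :
    (x + t ∉ D ∧ x - t ∉ D) ∨ (x + s + t ∈ D ∧ x + s - t ∈ D) := by
  have hPs := hP s (by simp)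
  have hPt := hP t (by simp)
  have hQt := hQ t (by simp)
  have e1 : x + t + s = x + s + t := by abel
  have e2 : x - t + s = x + s - t := by abel
  have h1 : x + t ∉ D ∨ x + s + t ∈ D := by
    by_contra! h
    have := hPs x (x + t) hx hxs h.1 (by rw [e1]; exact h.2)
    exact ht (by simpa using this)
  have h2 : x - t ∉ D ∨ x + s - t ∈ D := by
    by_contra! h
    have := hPs x (x - t) hx hxs h.1 (by rw [e2]; exact h.2)
    exact ht (sub_eq_self.1 this.symm)
  by_cases h3 : x + t ∉ D
  · by_cases h4 : x - t ∉ D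
    · exact Or.inl ⟨h3, h4⟩
    · have h5 := h2.resolve_left h4
      have := hPt x (x + s - t) hx h3 h5 (by simpa using hxs)
      refine absurd ?_ hst
      rw [add_sub_assoc, left_eq_add, sub_eq_zero] at this
      exact this
  · have h5 := h1.resolve_left h3
    by_cases h6 : x + s - t ∈ D
    · exact Or.inr ⟨h5, h6⟩
    · have h4 := h2.resolve_right h6
      have := hQt (x + s) (x - t) hxs h5 h4 (by simpa using hx)
      refine absurd ?_ hst'
      rw [sub_eq_add_neg, add_right_inj] at this
      exact this

/-- A finite set in which every translation by an element of `S` moves at most one point out is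
trivial or nearly everything. -/
theorem card_closure_le_of_small_boundary [Finite G] {D S : Finset G} (h0 : 0 ∉ S)
    (hbd : ∀ s ∈ S, (D.filter (fun x => x + s ∉ D)).card ≤ 1) (h0D : 0 ∈ D) (hD : 1 < D.card)
    (hDS : ∀ x ∈ D, x ∈ AddSubgroup.closure (S : Set G))
    {s x t₀ : G} (hs : s ∈ S) (hss : s + s ≠ 0) (hx : x ∈ D) (hxs : x + s ∉ D)
    (ht₀ : t₀ ∈ S) (hst₀ : s ≠ t₀) (hst₀' : s ≠ -t₀) :
    Nat.card (AddSubgroup.closure (S : Set G)) ≤ D.card + 1 := by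
  have hP : ∀ u ∈ S, ∀ y z, y ∈ D → y + u ∉ D → z ∈ D → z + u ∉ D → y = z := by
    intro u hu y z hy hyu hz hzu
    exact Finset.card_le_one.1 (hbd u hu) y (by simp [hy, hyu]) z (by simp [hz, hzu])
  have hQ : ∀ u ∈ S, ∀ y z, y ∉ D → y + u ∈ D → z ∉ D → z + u ∈ D → y = z := by
    intro u hu y z hy hyu hz hzu
    refine Finset.card_le_one.1 ((card_enter_eq_card_leave D u).trans_le (hbd u hu)) y ?_ z ?_
    · simp only [Finset.mem_sdiff, Finset.mem_image]
      exact ⟨⟨_, hyu, by simp⟩, hy⟩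
    · simp only [Finset.mem_sdiff, Finset.mem_image]
      exact ⟨⟨_, hzu, by simp⟩, hz⟩
  have key : ∀ t ∈ S, s ≠ t → s ≠ -t →
      (x + t ∉ D ∧ x - t ∉ D ∧ x - s ∉ D) ∨
        (x + s + t ∈ D ∧ x + s - t ∈ D ∧ x + s + s ∈ D) := by
    intro t ht hst hst'
    have ht0 : t ≠ 0 := fun h => h0 (h ▸ ht)
    have hs0 : s ≠ 0 := fun h => h0 (h ▸ hs)
    have hts' : t ≠ -s := fun h => hst' (by rw [h, neg_neg])
    have hP1 : ∀ u ∈ ({s, t} : Set G), ∀ y z, y ∈ D → y + u ∉ D → z ∈ D → z + u ∉ D → y = z := by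
      rintro u (rfl | rfl)
      exacts [hP _ hs, hP _ ht]
    have hQ1 : ∀ u ∈ ({s, t} : Set G), ∀ y z, y ∉ D → y + u ∈ D → z ∉ D → z + u ∈ D → y = z := by
      rintro u (rfl | rfl)
      exacts [hQ _ hs, hQ _ ht]
    have hP2 := hP1
    have hQ2 := hQ1
    rw [Set.pair_comm] at hP2 hQ2
    rcases isolated_or_hole hP1 hQ1 ht0 hst hst' hx hxs with ⟨h1, h2⟩ | ⟨h1, h2⟩
    · rcases isolated_or_hole hP2 hQ2 hs0 hst.symm hts' hx h1 with ⟨h3, h4⟩ | ⟨h3, h4⟩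
      · exact Or.inl ⟨h1, h2, h4⟩
      · have := hP s hs x (x + t - s) hx hxs h4 (by simpa using h1)
        rw [add_sub_assoc, left_eq_add, sub_eq_zero] at this
        exact absurd this.symm hst
    · rcases isolated_or_hole hP2 hQ2 hs0 hst.symm hts' h2 (by simpa using hxs) with
        ⟨h3, h4⟩ | ⟨h3, h4⟩
      · have := hP s hs x (x + s - t) hx hxs h2 h3
        rw [add_sub_assoc, left_eq_add, sub_eq_zero] at this
        exact absurd this hst
      · exact Or.inr ⟨h1, h2, by simpa using h3⟩
  by_cases hiso : x - s ∉ D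
  · exfalso
    have hall : ∀ t ∈ S, x + t ∉ D ∧ x - t ∉ D := by
      intro t ht
      by_cases hst : s = t
      · subst hst; exact ⟨hxs, hiso⟩
      by_cases hst' : s = -t
      · have : t = -s := by rw [hst', neg_neg]
        subst this
        exact ⟨by rwa [← sub_eq_add_neg], by rwa [sub_neg_eq_add]⟩
      rcases key t ht hst hst' with h | h
      · exact ⟨h.1, h.2.1⟩
      · have := hQ s hs (x + s) (x - s) hxs h.2.2 hiso (by simpa using hx)
        rw [sub_eq_add_neg, add_right_inj, eq_neg_iff_add_eq_zero] at this
        exact absurd this hss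
    have hcl : ∀ v ∈ {v | v ∈ D ∧ v ≠ x}, ∀ t ∈ (S : Set G), v + t ∈ {v | v ∈ D ∧ v ≠ x} := by
      rintro v ⟨hv, hvx⟩ t ht
      refine ⟨?_, ?_⟩
      · by_contra h
        exact hvx (hP t ht v x hv h hx (hall t ht).1)
      · rintro rfl
        exact (hall t ht).2 (by simpa using hv)
    obtain ⟨v, hv, hvx⟩ := Finset.exists_mem_ne hD x
    have := add_mem_of_closed hcl (v := v) ⟨hv, hvx⟩ (h := x - v) (sub_mem (hDS x hx) (hDS v hv))
    exact this.2 (by abel)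
  · push Not at hiso
    have hss' : x + s + s ∈ D := by
      rcases key t₀ ht₀ hst₀ hst₀' with h | h
      exacts [absurd hiso h.2.2, h.2.2]
    have hall : ∀ t ∈ S, x + s + t ∈ D ∧ x + s - t ∈ D := by
      intro t ht
      by_cases hst : s = t
      · subst hst; exact ⟨hss', by simpa using hx⟩
      by_cases hst' : s = -t
      · have : t = -s := by rw [hst', neg_neg]
        subst this
        exact ⟨by simpa using hx, by rwa [sub_neg_eq_add]⟩
      rcases key t ht hst hst' with h | h
      exacts [absurd hiso h.2.2, ⟨h.1, h.2.1⟩]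
    have hcl : ∀ v ∈ {v | v ∉ D ∧ v ≠ x + s}, ∀ t ∈ (S : Set G),
        v + t ∈ {v | v ∉ D ∧ v ≠ x + s} := by
      rintro v ⟨hv, hvx⟩ t ht
      refine ⟨fun h => hvx (hQ t ht v (x + s) hv h hxs (hall t ht).1), fun h => ?_⟩
      have := (hall t ht).2
      rw [← h, add_sub_cancel_right] at this
      exact hv this
    have hsub : (AddSubgroup.closure (S : Set G) : Set G) ⊆ (insert (x + s) D : Finset G) := by
      intro v hv
      by_contra h
      simp only [Finset.coe_insert, Set.mem_insert_iff, Finset.mem_coe, not_or] at h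
      have := add_mem_of_closed hcl (v := v) ⟨h.2, h.1⟩ (h := -v) (neg_mem hv)
      exact this.1 (by simpa using h0D)
    calc Nat.card (AddSubgroup.closure (S : Set G))
        = (AddSubgroup.closure (S : Set G) : Set G).ncard := rfl
      _ ≤ (insert (x + s) D : Finset G).card := by
        rw [← Set.ncard_coe_finset]
        exact Set.ncard_le_ncard hsub (Finset.finite_toSet _)
      _ ≤ D.card + 1 := Finset.card_insert_le _ _

theorem insert_zero_subset_allSums (S : Finset G) : insert 0 S ⊆ allSums S.val := by
  intro x hx
  rcases Finset.mem_insert.1 hx with rfl | hx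
  exacts [zero_mem_allSums _, mem_allSums_of_mem hx]

theorem card_succ_le_card_allSums {S : Finset G} (h0 : 0 ∉ S) :
    S.card + 1 ≤ (allSums S.val).card := by
  rw [← Finset.card_insert_of_notMem h0]
  exact Finset.card_le_card (insert_zero_subset_allSums S)

theorem allSums_subset_closure (S : Finset G) :
    ∀ x ∈ allSums S.val, x ∈ AddSubgroup.closure (S : Set G) := by
  intro x hx
  obtain ⟨B, hB, rfl⟩ := mem_allSums.1 hx
  exact AddSubgroup.multiset_sum_mem _ _
    fun y hy => AddSubgroup.subset_closure (Multiset.mem_of_le hB hy)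

theorem allSums_erase {S : Finset G} {s : G} (hs : s ∈ S) :
    allSums S.val = allSums (S.erase s).val ∪ (allSums (S.erase s).val).image (· + s) := by
  rw [← allSums_cons, Finset.erase_val, Multiset.cons_erase hs]

theorem card_leave_le {S : Finset G} {s : G} (hs : s ∈ S) :
    ((allSums S.val).filter (fun x => x + s ∉ allSums S.val)).card
      + (allSums (S.erase s).val).card ≤ (allSums S.val).card := by
  have hsub : allSums (S.erase s).val ⊆ allSums S.val := by
    rw [allSums_erase hs]; exact Finset.subset_union_left
  rw [← Finset.card_sdiff_add_card_eq_card hsub]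
  gcongr
  intro x hx
  obtain ⟨hx, hxs⟩ := Finset.mem_filter.1 hx
  refine Finset.mem_sdiff.2 ⟨hx, fun h => hxs ?_⟩
  rw [allSums_erase hs]
  exact Finset.mem_union_right _ (Finset.mem_image_of_mem _ h)

/-- If `S` loses generators when `s` is removed, its subset sums double. -/
theorem card_allSums_of_notMem_closure {S : Finset G} {s : G} (hs : s ∈ S)
    (h : s ∉ AddSubgroup.closure ((S.erase s : Finset G) : Set G)) :
    (allSums S.val).card = 2 * (allSums (S.erase s).val).card := by
  rw [allSums_erase hs, Finset.card_union_of_disjoint,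
    Finset.card_image_of_injective _ (add_left_injective s), two_mul]
  rw [Finset.disjoint_left]
  intro x hx hx'
  obtain ⟨y, hy, rfl⟩ := Finset.mem_image.1 hx'
  have := sub_mem (allSums_subset_closure _ _ hx) (allSums_subset_closure _ _ hy)
  exact h (by simpa using this)

theorem closure_erase_eq {S : Finset G} {s : G}
    (h : s ∈ AddSubgroup.closure ((S.erase s : Finset G) : Set G)) :
    AddSubgroup.closure (S : Set G) = AddSubgroup.closure ((S.erase s : Finset G) : Set G) := by
  apply le_antisymm
  · rw [AddSubgroup.closure_le]
    intro x hx
    by_cases hxs : x = s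
    · rwa [hxs]
    · exact AddSubgroup.subset_closure (by simpa [hxs] using hx)
  · exact AddSubgroup.closure_mono (by simp)

/-- In a finite abelian group with at most one involution, a set of `n` nonzero elements has at
least `2 * n - 1` subset sums, or all but at most one element of the subgroup it generates. -/
theorem min_le_card_allSums [Finite G]
    (hinv : ∀ x y : G, x ≠ 0 → y ≠ 0 → x + x = 0 → y + y = 0 → x = y) :
    ∀ (n : ℕ) (S : Finset G), S.card = n → 0 ∉ S →
      min (Nat.card (AddSubgroup.closure (S : Set G)) - 1) (2 * n - 1) ≤ (allSums S.val).card := by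
  intro n
  induction n with
  | zero => intro S _ _; simp
  | succ n ih =>
    intro S hcard h0
    have hle := card_succ_le_card_allSums h0
    by_cases hn : n + 1 ≤ 2
    · omega
    have hih : ∀ s ∈ S, min (Nat.card (AddSubgroup.closure ((S.erase s : Finset G) : Set G)) - 1)
        (2 * n - 1) ≤ (allSums (S.erase s).val).card := fun s hs =>
      ih _ (by rw [Finset.card_erase_of_mem hs, hcard]; rfl)
        (fun h => h0 (Finset.mem_of_mem_erase h))
    by_cases hgen : ∀ s ∈ S, s ∈ AddSubgroup.closure ((S.erase s : Finset G) : Set G)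
    · by_contra! hlt
      have hbd : ∀ s ∈ S, ((allSums S.val).filter (fun x => x + s ∉ allSums S.val)).card ≤ 1 := by
        intro s hs
        have h1 := hih s hs
        rw [← closure_erase_eq (hgen s hs)] at h1
        have h2 := card_leave_le hs
        omega
      have hex : ∃ s ∈ S, s + s ≠ 0 ∧ ∃ x ∈ allSums S.val, x + s ∉ allSums S.val := by
        by_contra! hno
        have hfull : ∀ T ⊆ S, (∀ t ∈ T, t + t ≠ 0) →
            AddSubgroup.closure (S : Set G) = AddSubgroup.closure (T : Set G) → False := by
          intro T hTS hT hcl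
          have hsub : (AddSubgroup.closure (S : Set G) : Set G) ⊆ (allSums S.val : Finset G) := by
            intro v hv
            rw [hcl] at hv
            have := add_mem_of_closed (S := (T : Set G)) (T := (allSums S.val : Set G))
              (fun v hv t ht => hno t (hTS ht) (hT t ht) v hv) (zero_mem_allSums _) hv
            simpa using this
          have := Set.ncard_le_ncard hsub (Finset.finite_toSet _)
          rw [Set.ncard_coe_finset] at this
          have h3 : Nat.card (AddSubgroup.closure (S : Set G))
            = (AddSubgroup.closure (S : Set G) : Set G).ncard := rfl
          omega
        by_cases hu : ∃ u ∈ S, u + u = 0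
        · obtain ⟨u, hu, huu⟩ := hu
          refine hfull (S.erase u) (Finset.erase_subset _ _) ?_ (closure_erase_eq (hgen u hu))
          intro t ht htt
          obtain ⟨htu, ht⟩ := Finset.mem_erase.1 ht
          exact htu (hinv t u (fun h => h0 (h ▸ ht)) (fun h => h0 (h ▸ hu)) htt huu)
        · push Not at hu
          exact hfull S subset_rfl hu rfl
      obtain ⟨s, hs, hss, x, hx, hxs⟩ := hex
      obtain ⟨t, ht, hts⟩ : ∃ t ∈ S, t ∉ ({s, -s} : Finset G) := by
        by_contra! h
        have := Finset.card_le_card h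
        have := Finset.card_le_two (a := s) (b := -s)
        omega
      simp only [Finset.mem_insert, Finset.mem_singleton, not_or] at hts
      have := card_closure_le_of_small_boundary h0 hbd (zero_mem_allSums _) (by omega)
        (allSums_subset_closure S) hs hss hx hxs ht (fun h => hts.1 h.symm)
        (fun h => hts.2 (by rw [h, neg_neg]))
      omega
    · push Not at hgen
      obtain ⟨s, hs, hsc⟩ := hgen
      have h2 := card_allSums_of_notMem_closure hs hsc
      have h3 : (S.erase s).card + 1 ≤ (allSums (S.erase s).val).card :=
        card_succ_le_card_allSums (fun h => h0 (Finset.mem_of_mem_erase h))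
      rw [Finset.card_erase_of_mem hs] at h3
      omega

/-- A set containing `0` and more than half of a finite abelian group with at most one involution,
with some slack, has every element as a subset sum. -/
theorem allSums_eq_univ [Fintype G]
    (hinv : ∀ x y : G, x ≠ 0 → y ≠ 0 → x + x = 0 → y + y = 0 → x = y)
    {S : Finset G} (h0 : 0 ∉ S) (hcard : Fintype.card G + 1 ≤ 2 * S.card) :
    allSums S.val = Finset.univ := by
  refine Finset.eq_univ_of_forall fun x => ?_
  set B := insert 0 S with hB
  have hBc : B.card = S.card + 1 := Finset.card_insert_of_notMem h0
  set E := B ∩ B.image (x - ·) with hE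
  have hEc : 2 < E.card := by
    have h1 := Finset.card_union_add_card_inter B (B.image (x - ·))
    have h2 := Finset.card_le_univ (B ∪ B.image (x - ·))
    have h3 := Finset.card_image_of_injective B (sub_right_injective (b := x))
    rw [← hE] at h1
    omega
  obtain ⟨b, hb, hbx⟩ : ∃ b ∈ E, b + b ≠ x := by
    by_contra! h
    obtain ⟨b, hb, c, hc, d, hd, hbc, hbd, hcd⟩ := Finset.two_lt_card.1 hEc
    have := hinv (c - b) (d - b) (sub_ne_zero.2 hbc.symm) (sub_ne_zero.2 hbd.symm)
      (by rw [sub_add_sub_comm, h b hb, h c hc, sub_self])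
      (by rw [sub_add_sub_comm, h b hb, h d hd, sub_self])
    exact hcd (sub_left_injective this)
  obtain ⟨hbB, hb'⟩ := Finset.mem_inter.1 hb
  obtain ⟨c, hcB, hcb⟩ := Finset.mem_image.1 hb'
  have hbc : b ≠ c := by
    rintro rfl
    exact hbx (by nth_rewrite 1 [← hcb]; abel)
  have hxbc : b + c = x := by rw [← hcb]; abel
  rcases Finset.mem_insert.1 hbB with rfl | hbS
  · rw [← hxbc, zero_add]
    exact insert_zero_subset_allSums S hcB
  rcases Finset.mem_insert.1 hcB with rfl | hcS
  · rw [← hxbc, add_zero]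
    exact insert_zero_subset_allSums S hbB
  refine mem_allSums.2 ⟨({b, c} : Finset G).val, ?_, ?_⟩
  · rw [Finset.val_le_iff]
    intro y hy
    rcases Finset.mem_insert.1 hy with rfl | hy
    · exact hbS
    · rwa [Finset.mem_singleton.1 hy]
  · rw [← hxbc]
    rw [Finset.sum_val, Finset.sum_pair hbc]
    rfl

end SubsetSums

theorem ZMod.eq_of_add_self_eq_zero {m : ℕ} [NeZero m] (x y : ZMod m) (hx : x ≠ 0) (hy : y ≠ 0)
    (hxx : x + x = 0) (hyy : y + y = 0) : x = y := by
  have h1 := ((ZMod.neg_eq_self_iff x).1 (neg_eq_of_add_eq_zero_left hxx)).resolve_left hx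
  have h2 := ((ZMod.neg_eq_self_iff y).1 (neg_eq_of_add_eq_zero_left hyy)).resolve_left hy
  exact ZMod.val_injective m (by omega)

/-- Adjoining a positive integer `m` produces a new sum in every residue class modulo `m` that
already contains a sum. -/
theorem card_allSums_cons_ge (M : Multiset ℤ) {m : ℕ} (hm : 0 < m) :
    (allSums M).card + (allSums (M.map (Int.castAddHom (ZMod m)))).card
      ≤ (allSums ((m : ℤ) ::ₘ M)).card := by
  rw [allSums_cons, card_union_image_add, allSums_map]
  gcongr
  refine (Finset.card_le_card ?_).trans (Finset.card_image_le (f := Int.castAddHom (ZMod m)))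
  intro y hy
  obtain ⟨x, hx, rfl⟩ := Finset.mem_image.1 hy
  obtain ⟨z, hz, hmax⟩ := Finset.exists_max_image
    ((allSums M).filter (fun z : ℤ => (z : ZMod m) = x)) id ⟨x, by simp [hx]⟩
  obtain ⟨hz, hzx⟩ := Finset.mem_filter.1 hz
  refine Finset.mem_image.2 ⟨z, Finset.mem_filter.2 ⟨hz, fun h => ?_⟩, by simpa using hzx⟩
  have := hmax (z + m) (Finset.mem_filter.2 ⟨h, by simpa using hzx⟩)
  simp only [id] at this
  omega

section IncreasingSequence

variable {k : ℕ} {a : ℕ → ℤ}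

theorem injOn_cast_of_increasing (ha : ∀ i j, 1 ≤ i → i < j → j ≤ k → a i < a j)
    (hpos : ∀ i, 1 ≤ i → i ≤ k → 0 < a i) {j : ℕ} (hj : 1 ≤ j) (hjk : j ≤ k) {m : ℕ}
    (hm : (m : ℤ) = a j) :
    Set.InjOn (fun i => (a i : ZMod m)) (Finset.Icc 1 (j - 1) : Finset ℕ) ∧
      0 ∉ (Finset.Icc 1 (j - 1)).image (fun i => (a i : ZMod m)) := by
  have hb : ∀ i, 1 ≤ i → i ≤ j - 1 → 0 < a i ∧ a i < m := fun i h1 h2 =>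
    ⟨hpos i h1 (by omega), hm ▸ ha i j h1 (by omega) hjk⟩
  constructor
  · intro x hx y hy hxy
    simp only [Finset.coe_Icc, Set.mem_Icc] at hx hy
    have h1 := hb x hx.1 hx.2
    have h2 := hb y hy.1 hy.2
    have h3 := (ZMod.intCast_eq_intCast_iff' _ _ _).1 hxy
    rw [Int.emod_eq_of_lt h1.1.le h1.2, Int.emod_eq_of_lt h2.1.le h2.2] at h3
    rcases lt_trichotomy x y with h | h | h
    · have := ha x y hx.1 h (by omega)
      omega
    · exact h
    · have := ha y x hy.1 h (by omega)
      omega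
  · intro h
    obtain ⟨x, hx, hx0⟩ := Finset.mem_image.1 h
    rw [Finset.mem_Icc] at hx
    have h1 := hb x hx.1 hx.2
    have := (ZMod.intCast_zmod_eq_zero_iff_dvd _ _).1 hx0
    exact absurd (Int.le_of_dvd h1.1 this) (by omega)

theorem map_cast_eq_image_val {m : ℕ} {I : Finset ℕ}
    (h : Set.InjOn (fun i => (a i : ZMod m)) I) :
    (I.val.map a).map (Int.castAddHom (ZMod m)) = (I.image (fun i => (a i : ZMod m))).val := by
  rw [Finset.image_val_of_injOn h, Multiset.map_map]
  rfl

theorem card_allSums_cons_ge_add_index (ha : ∀ i j, 1 ≤ i → i < j → j ≤ k → a i < a j)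
    (hpos : ∀ i, 1 ≤ i → i ≤ k → 0 < a i) {j : ℕ} (hj : 1 ≤ j) (hjk : j ≤ k) {M : Multiset ℤ}
    (hM : (Finset.Icc 1 (j - 1)).val.map a ≤ M) :
    (allSums M).card + j ≤ (allSums (a j ::ₘ M)).card := by
  obtain ⟨m, hm⟩ := Int.eq_ofNat_of_zero_le (hpos j hj hjk).le
  have hmpos : 0 < m := by have := hpos j hj hjk; omega
  obtain ⟨hinj, h0⟩ := injOn_cast_of_increasing ha hpos hj hjk hm.symm
  rw [hm]
  refine le_trans ?_ (card_allSums_cons_ge M hmpos)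
  gcongr
  have h1 := card_succ_le_card_allSums h0
  rw [Finset.card_image_of_injOn hinj, ← map_cast_eq_image_val hinj, Nat.card_Icc] at h1
  have h2 := Finset.card_le_card (allSums_mono
    (Multiset.map_le_map (f := Int.castAddHom (ZMod m)) hM))
  omega

theorem Icc_val_map_eq_cons {j : ℕ} (hj : 1 ≤ j) :
    (Finset.Icc 1 j).val.map a = a j ::ₘ (Finset.Icc 1 (j - 1)).val.map a := by
  obtain ⟨j, rfl⟩ := Nat.exists_eq_add_of_le' hj
  rw [← Finset.insert_Icc_right_eq_Icc_add_one (by omega), Finset.insert_val_of_notMem (by simp),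
    Multiset.map_cons, Nat.add_sub_cancel]

theorem one_add_sum_le_card_allSums (ha : ∀ i j, 1 ≤ i → i < j → j ≤ k → a i < a j)
    (hpos : ∀ i, 1 ≤ i → i ≤ k → 0 < a i) {j : ℕ} (hjk : j ≤ k) :
    1 + ∑ i ∈ Finset.Icc 1 j, i ≤ (allSums ((Finset.Icc 1 j).val.map a)).card := by
  induction j with
  | zero => simp [allSums_zero]
  | succ j ih =>
    have h1 := card_allSums_cons_ge_add_index ha hpos (j := j + 1) (by omega) hjk le_rfl
    rw [← Icc_val_map_eq_cons (by omega), Nat.add_sub_cancel] at h1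
    rw [Finset.sum_Icc_succ_top (by omega)]
    have := ih (by omega)
    omega

theorem card_allSums_add_replicate_ge (ha : ∀ i j, 1 ≤ i → i < j → j ≤ k → a i < a j)
    (hpos : ∀ i, 1 ≤ i → i ≤ k → 0 < a i) {j : ℕ} (hj : 1 ≤ j) (hjk : j ≤ k) {M : Multiset ℤ}
    (hM : (Finset.Icc 1 (j - 1)).val.map a ≤ M) (n : ℕ) :
    (allSums M).card + j * n ≤ (allSums (Multiset.replicate n (a j) + M)).card := by
  induction n with
  | zero => simp
  | succ n ih =>
    have := card_allSums_cons_ge_add_index ha hpos hj hjk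
      (hM.trans (Multiset.le_add_left M (Multiset.replicate n (a j))))
    rw [Multiset.replicate_succ, Multiset.cons_add]
    linarith

theorem card_allSums_add_sum_ge (ha : ∀ i j, 1 ≤ i → i < j → j ≤ k → a i < a j)
    (hpos : ∀ i, 1 ≤ i → i ≤ k → 0 < a i) (e : ℕ → ℕ) {I : Finset ℕ}
    (hI : I ⊆ Finset.Icc 1 k) :
    (allSums ((Finset.Icc 1 k).val.map a)).card + ∑ i ∈ I, i * e i ≤
      (allSums (∑ i ∈ I, Multiset.replicate (e i) (a i) + (Finset.Icc 1 k).val.map a)).card := by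
  induction I using Finset.induction_on with
  | empty => simp
  | insert j I hj ih =>
    have hjk := Finset.mem_Icc.1 (hI (Finset.mem_insert_self j I))
    have h1 := ih ((Finset.subset_insert j I).trans hI)
    have h2 : (Finset.Icc 1 (j - 1)).val.map a ≤
        ∑ i ∈ I, Multiset.replicate (e i) (a i) + (Finset.Icc 1 k).val.map a :=
      (Multiset.map_le_map (Finset.val_le_iff.2 (Finset.Icc_subset_Icc_right (by omega)))).trans
        (Multiset.le_add_left _ _)
    have h3 := card_allSums_add_replicate_ge ha hpos hjk.1 hjk.2 h2 (e j)
    rw [Finset.sum_insert hj, Finset.sum_insert hj, add_assoc (Multiset.replicate _ _)]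
    linarith

/-- Bounds for sums over subsets with each value used at most once. -/
theorem card_allSums_map_ge (hk : 1 ≤ k) (ha : ∀ i j, 1 ≤ i → i < j → j ≤ k → a i < a j)
    (hpos : ∀ i, 1 ≤ i → i ≤ k → 0 < a i) (hgcd : (Finset.Icc 1 k).gcd a = 1) {m : ℕ}
    (hm : (m : ℤ) = a k) :
    (m + 3 ≤ 2 * k → 1 + ∑ i ∈ Finset.Icc 1 (k - 1), i + m ≤
      (allSums ((Finset.Icc 1 k).val.map a)).card) ∧
    (2 * k ≤ m + 2 → 1 + ∑ i ∈ Finset.Icc 1 (k - 1), i + (2 * k - 3) ≤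
      (allSums ((Finset.Icc 1 k).val.map a)).card) := by
  have hmpos : 0 < m := by have := hpos k hk le_rfl; omega
  have : NeZero m := ⟨hmpos.ne'⟩
  obtain ⟨hinj, h0⟩ := injOn_cast_of_increasing ha hpos hk le_rfl hm
  have h1 := one_add_sum_le_card_allSums ha hpos (j := k - 1) (by omega)
  have h2 := card_allSums_cons_ge ((Finset.Icc 1 (k - 1)).val.map a) hmpos
  rw [hm, ← Icc_val_map_eq_cons hk, map_cast_eq_image_val hinj] at h2
  set S := (Finset.Icc 1 (k - 1)).image (fun i => (a i : ZMod m)) with hS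
  have hcard : S.card = k - 1 := by
    rw [hS, Finset.card_image_of_injOn hinj, Nat.card_Icc]
    omega
  constructor
  · intro h
    rw [allSums_eq_univ ZMod.eq_of_add_self_eq_zero h0 (by rw [ZMod.card, hcard]; omega),
      Finset.card_univ, ZMod.card] at h2
    omega
  · intro h
    have h3 := min_le_card_allSums ZMod.eq_of_add_self_eq_zero _ S hcard h0
    have hone : (1 : ZMod m) ∈ AddSubgroup.closure (S : Set (ZMod m)) := by
      obtain ⟨f, hf⟩ := Finset.gcd_eq_sum_mul (Finset.Icc 1 k) a
      rw [hgcd] at hf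
      have hf' := congrArg (Int.cast : ℤ → ZMod m) hf
      push_cast at hf'
      rw [hf']
      refine sum_mem fun i hi => ?_
      rw [Finset.mem_Icc] at hi
      have hmem : (a i : ZMod m) ∈ AddSubgroup.closure (S : Set (ZMod m)) := by
        by_cases hik : i = k
        · rw [hik, ← hm]
          simp
        · exact AddSubgroup.subset_closure
            (Finset.mem_image_of_mem _ (Finset.mem_Icc.2 ⟨hi.1, by omega⟩))
      rw [mul_comm, ← zsmul_eq_mul]
      exact zsmul_mem hmem _
    have htop : AddSubgroup.closure (S : Set (ZMod m)) = ⊤ := by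
      refine (AddSubgroup.eq_top_iff' _).2 fun x => ?_
      have := zsmul_mem hone (x.val : ℤ)
      simpa using this
    rw [htop, AddSubgroup.card_top, Nat.card_zmod] at h3
    omega

end IncreasingSequence

theorem card_allSums_le_card_SeqSub (M : Multiset ℤ) :
    (allSums M).card ≤ (SeqSub M).card + 1 := by
  refine (Finset.card_le_card ?_).trans (Finset.card_insert_le 0 _)
  intro x hx
  obtain ⟨B, hB, rfl⟩ := mem_allSums.1 hx
  by_cases h : B = 0
  · simp [h]
  · refine Finset.mem_insert_of_mem ?_
    simp only [SeqSub, Multiset.mem_toFinset, Multiset.mem_map, Multiset.mem_filter,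
      Multiset.mem_powerset]
    exact ⟨B, ⟨hB, h⟩, rfl⟩

theorem freiman_subsequence_sum (k : ℕ) (hk : 3 ≤ k) (a : ℕ → ℤ) (r : ℕ → ℕ)
    (ha : ∀ i j, 1 ≤ i → i < j → j ≤ k → a i < a j)
    (hpos : ∀ i, 1 ≤ i → i ≤ k → 0 < a i)
    (hr : ∀ i, 1 ≤ i → i ≤ k → 1 ≤ r i)
    (hgcd : (Finset.Icc 1 k).gcd a = 1) :
    (a k ≤ 2 * (k : ℤ) - 3 →
      (∑ i ∈ Finset.Icc 1 k, (i : ℤ) * (r i : ℤ)) + a k - (k : ℤ)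
        ≤ ((SeqSub (∑ i ∈ Finset.Icc 1 k, Multiset.replicate (r i) (a i))).card : ℤ)) ∧
    (2 * (k : ℤ) - 2 ≤ a k →
      (∑ i ∈ Finset.Icc 1 k, (i : ℝ) * (r i : ℝ)) + theta * ((k : ℝ) + 1) - (k : ℝ) - 4
        ≤ ((SeqSub (∑ i ∈ Finset.Icc 1 k, Multiset.replicate (r i) (a i))).card : ℝ)) := by
  obtain ⟨m, hm⟩ := Int.eq_ofNat_of_zero_le (hpos k (by omega) le_rfl).le
  obtain ⟨hsmall, hlarge⟩ := card_allSums_map_ge (by omega) ha hpos hgcd hm.symm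
  have hM : ∑ i ∈ Finset.Icc 1 k, Multiset.replicate (r i) (a i) =
      ∑ i ∈ Finset.Icc 1 k, Multiset.replicate (r i - 1) (a i) + (Finset.Icc 1 k).val.map a := by
    have : (Finset.Icc 1 k).val.map a = ∑ i ∈ Finset.Icc 1 k, {a i} := by
      rw [← Multiset.sum_map_singleton ((Finset.Icc 1 k).val.map a), Multiset.map_map]
      rfl
    rw [this, ← Finset.sum_add_distrib]
    refine Finset.sum_congr rfl fun i hi => ?_
    rw [Finset.mem_Icc] at hi
    have := hr i hi.1 hi.2
    rw [← Multiset.replicate_one, ← Multiset.replicate_add, Nat.sub_add_cancel this]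
  have hsum : ∑ i ∈ Finset.Icc 1 k, i * r i =
      ∑ i ∈ Finset.Icc 1 k, i * (r i - 1) + (∑ i ∈ Finset.Icc 1 (k - 1), i + k) := by
    have : ∑ i ∈ Finset.Icc 1 (k - 1), i + k = ∑ i ∈ Finset.Icc 1 k, i := by
      obtain ⟨n, rfl⟩ := Nat.exists_eq_add_of_le' (show 1 ≤ k by omega)
      rw [Finset.sum_Icc_succ_top (by omega), Nat.add_sub_cancel]
    rw [this, ← Finset.sum_add_distrib]
    refine Finset.sum_congr rfl fun i hi => ?_
    rw [Finset.mem_Icc] at hi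
    obtain ⟨n, hn⟩ := Nat.exists_eq_add_of_le' (hr i hi.1 hi.2)
    rw [hn, Nat.add_sub_cancel]
    ring
  have hbase := card_allSums_add_sum_ge ha hpos (fun i => r i - 1) (I := Finset.Icc 1 k) subset_rfl
  have hseq := card_allSums_le_card_SeqSub (∑ i ∈ Finset.Icc 1 k, Multiset.replicate (r i) (a i))
  rw [← hM] at hbase
  set N := (SeqSub (∑ i ∈ Finset.Icc 1 k, Multiset.replicate (r i) (a i))).card
  constructor
  · intro h
    have := hsmall (by omega)
    have hN : ∑ i ∈ Finset.Icc 1 k, i * r i + m ≤ N + k := by omega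
    zify at hN
    rw [hm]
    linarith
  · intro h
    have := hlarge (by omega)
    have hN : ∑ i ∈ Finset.Icc 1 k, i * r i + k ≤ N + 3 := by omega
    have hN' : (∑ i ∈ Finset.Icc 1 k, (i : ℝ) * (r i : ℝ)) + k ≤ N + 3 := by exact_mod_cast hN
    have hsqrt : Real.sqrt 5 ≤ 9 / 4 := Real.sqrt_le_iff.2 (by norm_num)
    have hk' : (3 : ℝ) ≤ k := by exact_mod_cast hk
    have hth : theta ≤ 13 / 8 := by unfold theta; linarith
    nlinarith
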